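/- arXiv:2003.09618 — 2 statements merged into one kernel-verified Lean document; each statement's English description precedes it below -/
import Mathlib

section
/- Let d ≥ 1, let c₀, …, c_d ∈ ℂ be nonzero with induced subdivision 0 = β₀ < β₁ < … < β_s = d, tropical roots τ₁, …, τ_d, and constants r_i. Let ε ≥ 0 and let x̃ = (x̃₁, …, x̃_d), x̂ = (x̂₁, …, x̂_d) ∈ (ℂ \ {0})^d satisfy |x̂_j − x̃_j| ≤ ε|x̃_j| for all j. Let c̃_i and ĉ_i denote the degree-i coefficients of c_d·∏_{j=1}^d (X − x̃_j) and c_d·∏_{j=1}^d (X − x̂_j). Fix i ∈ {0, …, d−1} and W_i ≥ 0, and assume |c_i − c̃_i| ≤ ε|c_i| and σ_{d−i}(|x̃₁|, …, |x̃_d|) ≤ W_i·∏_{k=i+1}^{d} e^{τ_k}. Then |ĉ_i − c_i| ≤ (ε + ((1 + ε)^{d−i} − 1)·W_i)·r_i·|c_i|. -/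
open Polynomial

/-- The `k`-th elementary symmetric polynomial
`σ_k(x₁, …, x_d) = Σ_{|I| = k} ∏_{j ∈ I} x_j`. -/
def esymm {R : Type*} [CommSemiring R] (d k : ℕ) (x : Fin d → R) : R :=
  ∑ I ∈ Finset.powersetCard k (Finset.univ : Finset (Fin d)), ∏ j ∈ I, x j

open Finset in
/-- The coefficients of `∏ j, (X - x_j)` in terms of the elementary symmetric polynomials. -/
theorem coeff_C_mul_prod_X_sub_C_eq_esymm {R : Type*} [CommRing R] {d i : ℕ} (hi : i ≤ d)
    (a : R) (x : Fin d → R) :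
    (C a * ∏ j : Fin d, (X - C (x j))).coeff i = a * ((-1) ^ (d - i) * esymm d (d - i) x) := by
  have key := Multiset.prod_X_sub_C_coeff (univ.val.map x) (k := i) (by simpa using hi)
  rw [Multiset.map_map, Multiset.card_map, card_val, card_univ, Fintype.card_fin,
    Finset.esymm_map_val] at key
  rw [coeff_C_mul]
  exact congrArg (a * ·) key

/-- Relative perturbations of the factors, of size at most `ε`, perturb a product of `n` factors
by at most `(1 + ε) ^ n - 1` in the relative sense. -/
theorem norm_prod_sub_prod_le_of_norm_sub_le {ι 𝕜 : Type*} [NormedField 𝕜] {ε : ℝ} (hε : 0 ≤ ε)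
    {a b : ι → 𝕜} (s : Finset ι) (h : ∀ j ∈ s, ‖a j - b j‖ ≤ ε * ‖b j‖) :
    ‖∏ j ∈ s, a j - ∏ j ∈ s, b j‖ ≤ ((1 + ε) ^ s.card - 1) * ∏ j ∈ s, ‖b j‖ := by
  classical
  induction s using Finset.induction_on with
  | empty => simp
  | insert j s hj ih =>
    have hjb := h j (Finset.mem_insert_self j s)
    have hs := ih fun k hk => h k (Finset.mem_insert_of_mem hk)
    have ha : ‖a j‖ ≤ (1 + ε) * ‖b j‖ := by
      linarith [norm_le_norm_add_norm_sub' (a j) (b j)]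
    rw [Finset.prod_insert hj, Finset.prod_insert hj, Finset.prod_insert hj,
      Finset.card_insert_of_notMem hj]
    set A := ∏ k ∈ s, a k
    set B := ∏ k ∈ s, b k
    have hB : ‖B‖ = ∏ k ∈ s, ‖b k‖ := norm_prod s b
    rw [← hB] at hs ⊢
    calc ‖a j * A - b j * B‖ = ‖a j * (A - B) + (a j - b j) * B‖ := by ring_nf
      _ ≤ ‖a j‖ * ‖A - B‖ + ‖a j - b j‖ * ‖B‖ := by
        simpa only [norm_mul] using norm_add_le (a j * (A - B)) ((a j - b j) * B)
      _ ≤ (1 + ε) * ‖b j‖ * (((1 + ε) ^ s.card - 1) * ‖B‖) + ε * ‖b j‖ * ‖B‖ := by gcongr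
      _ = ((1 + ε) ^ (s.card + 1) - 1) * (‖b j‖ * ‖B‖) := by ring

/-- The effect on the elementary symmetric polynomials of relative perturbations of size at most
`ε` of the variables. -/
theorem norm_esymm_sub_esymm_le {𝕜 : Type*} [NormedField 𝕜] {ε : ℝ} (hε : 0 ≤ ε) {d : ℕ} (k : ℕ)
    {x y : Fin d → 𝕜} (h : ∀ j, ‖y j - x j‖ ≤ ε * ‖x j‖) :
    ‖esymm d k y - esymm d k x‖ ≤ ((1 + ε) ^ k - 1) * esymm d k (fun j => ‖x j‖) := by
  rw [esymm, esymm, esymm, ← Finset.sum_sub_distrib, Finset.mul_sum]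
  refine norm_sum_le_of_le _ fun I hI => ?_
  rw [← (Finset.mem_powersetCard.mp hI).2]
  exact norm_prod_sub_prod_le_of_norm_sub_le hε I fun j _ => h j

/-- A sequence satisfying `g k = t (k + 1) * g (k + 1)` for `k < d` is a product of values of `t`
times its value at `d`. -/
theorem eq_mul_prod_Icc_of_forall_eq_mul_succ {M : Type*} [CommMonoid M] {d : ℕ} {g t : ℕ → M}
    (h : ∀ k < d, g k = t (k + 1) * g (k + 1)) {i : ℕ} (hi : i ≤ d) :
    g i = g d * ∏ k ∈ Finset.Icc (i + 1) d, t k := by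
  induction hi using Nat.decreasingInduction with
  | self => simp
  | of_succ k hk ih =>
    rw [h k hk, ih, ← Finset.mul_prod_Ioc_eq_prod_Icc (Nat.succ_le_of_lt hk),
      Finset.Icc_add_one_left_eq_Ioc, mul_left_comm]

/-- If `β 0 = 0` then every `i < β s` lies in some interval `[β (ℓ - 1), β ℓ)` with
`1 ≤ ℓ ≤ s`. -/
theorem exists_mem_Ico_of_lt {β : ℕ → ℕ} (hβ : β 0 = 0) {s i : ℕ} (hi : i < β s) :
    ∃ ℓ, 1 ≤ ℓ ∧ ℓ ≤ s ∧ β (ℓ - 1) ≤ i ∧ i < β ℓ := by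
  induction s with
  | zero => omega
  | succ s ih =>
    rcases lt_or_ge i (β s) with hlt | hge
    · obtain ⟨ℓ, h1, h2, h3⟩ := ih hlt
      exact ⟨ℓ, h1, h2.trans s.le_succ, h3⟩
    · exact ⟨s + 1, by omega, le_rfl, hge, hi⟩

/-- precise form of Theorem 3.3 of the paper (element-wise mixed backward
error `ε` implies tropical backward error `O(ε)`).  The roots are `x̃ = xt`, `x̂ = xh`
(indexed by `Fin d`), `c̃_i` and `ĉ_i` are the degree-`i` coefficients of
`c_d ∏ (X − x̃_j)` and `c_d ∏ (X − x̂_j)`, and the hypothesis on `σ_{d−i}` is the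
precise version of assumption (3.2). -/
theorem EMBE_implies_TBE
    (d s : ℕ) (hd : 1 ≤ d) (hs : 1 ≤ s)
    (c : ℕ → ℂ) (hc : ∀ i, i ≤ d → c i ≠ 0)
    (v : ℕ → ℝ) (hv : ∀ i, v i = Real.log ‖c i‖)
    (β : ℕ → ℕ) (hβ0 : β 0 = 0) (hβs : β s = d)
    (hβmono : ∀ ℓ, ℓ < s → β ℓ < β (ℓ + 1))
    (τ : ℕ → ℝ)
    (hτ : ∀ ℓ, 1 ≤ ℓ → ℓ ≤ s →
      τ ℓ = (v (β (ℓ - 1)) - v (β ℓ)) / ((β ℓ : ℝ) - (β (ℓ - 1) : ℝ)))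
    (hτmono : ∀ ℓ, 1 ≤ ℓ → ℓ < s → τ ℓ < τ (ℓ + 1))
    (hupper : ∀ ℓ i, 1 ≤ ℓ → ℓ ≤ s → β (ℓ - 1) ≤ i → i ≤ β ℓ →
      v i ≤ v (β ℓ) + ((β ℓ : ℝ) - (i : ℝ)) * τ ℓ)
    (r : ℕ → ℝ)
    (hr : ∀ ℓ i, 1 ≤ ℓ → ℓ ≤ s → β (ℓ - 1) ≤ i → i ≤ β ℓ →
      r i = Real.exp (v (β ℓ) + ((β ℓ : ℝ) - (i : ℝ)) * τ ℓ - v i))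
    (τr : ℕ → ℝ)
    (hτr : ∀ ℓ k, 1 ≤ ℓ → ℓ ≤ s → β (ℓ - 1) < k → k ≤ β ℓ → τr k = τ ℓ)
    (ε : ℝ) (hε : 0 ≤ ε)
    (xt xh : Fin d → ℂ)
    (hxt : ∀ j, xt j ≠ 0) (hxh : ∀ j, xh j ≠ 0)
    (h : ∀ j, ‖xh j - xt j‖ ≤ ε * ‖xt j‖)
    (i : ℕ) (hi : i < d) (W : ℝ) (hW : 0 ≤ W)
    (hci : ‖c i - (C (c d) * ∏ j : Fin d, (X - C (xt j))).coeff i‖ ≤ ε * ‖c i‖)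
    (hσ : esymm d (d - i) (fun j => ‖xt j‖) ≤
      W * ∏ k ∈ Finset.Icc (i + 1) d, Real.exp (τr k)) :
    ‖(C (c d) * ∏ j : Fin d, (X - C (xh j))).coeff i - c i‖ ≤
      (ε + ((1 + ε) ^ (d - i) - 1) * W) * r i * ‖c i‖ := by
  have hpos : ∀ k, k ≤ d → 0 < ‖c k‖ := fun k hk => norm_pos_iff.mpr (hc k hk)
  have hmul : ∀ k, k ≤ d → ∀ z : ℝ, Real.exp (z - v k) * ‖c k‖ = Real.exp z := fun k hk z => by
    rw [hv, Real.exp_sub, Real.exp_log (hpos k hk), div_mul_cancel₀ _ (hpos k hk).ne']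
  have hstep : ∀ k < d, r k * ‖c k‖ = Real.exp (τr (k + 1)) * (r (k + 1) * ‖c (k + 1)‖) := by
    intro k hk
    obtain ⟨ℓ, h1, h2, h3, h4⟩ := exists_mem_Ico_of_lt hβ0 (hβs ▸ hk)
    rw [hτr ℓ (k + 1) h1 h2 (by omega) h4, hr ℓ k h1 h2 h3 h4.le,
      hr ℓ (k + 1) h1 h2 (by omega) h4, hmul k hk.le, hmul (k + 1) hk, ← Real.exp_add]
    congr 1
    push_cast
    ring
  have hrd : r d * ‖c d‖ = ‖c d‖ := by
    have hle : β (s - 1) ≤ d := by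
      have := hβmono (s - 1) (by omega)
      rw [Nat.sub_add_cancel hs, hβs] at this
      exact this.le
    rw [hr s d hs le_rfl hle hβs.ge, hβs]
    simp
  have hprod : ‖c d‖ * ∏ k ∈ Finset.Icc (i + 1) d, Real.exp (τr k) = r i * ‖c i‖ := by
    rw [eq_mul_prod_Icc_of_forall_eq_mul_succ (g := fun k => r k * ‖c k‖)
      (t := fun k => Real.exp (τr k)) hstep hi.le, hrd]
  have hri : 1 ≤ r i := by
    obtain ⟨ℓ, h1, h2, h3, h4⟩ := exists_mem_Ico_of_lt hβ0 (hβs ▸ hi)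
    rw [hr ℓ i h1 h2 h3 h4.le, Real.one_le_exp_iff, sub_nonneg]
    exact hupper ℓ i h1 h2 h3 h4.le
  have hpow : 0 ≤ (1 + ε) ^ (d - i) - 1 := sub_nonneg.mpr (one_le_pow₀ (by linarith))
  have hdiff : ‖(C (c d) * ∏ j : Fin d, (X - C (xh j))).coeff i -
      (C (c d) * ∏ j : Fin d, (X - C (xt j))).coeff i‖ ≤
      ((1 + ε) ^ (d - i) - 1) * W * (r i * ‖c i‖) := by
    rw [coeff_C_mul_prod_X_sub_C_eq_esymm hi.le, coeff_C_mul_prod_X_sub_C_eq_esymm hi.le,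
      ← mul_sub, ← mul_sub, norm_mul, norm_mul, norm_pow, norm_neg, norm_one, one_pow, one_mul]
    calc ‖c d‖ * ‖esymm d (d - i) xh - esymm d (d - i) xt‖
        ≤ ‖c d‖ * (((1 + ε) ^ (d - i) - 1) *
            (W * ∏ k ∈ Finset.Icc (i + 1) d, Real.exp (τr k))) := by
          gcongr
          exact (norm_esymm_sub_esymm_le hε (d - i) h).trans (by gcongr)
      _ = ((1 + ε) ^ (d - i) - 1) * W * (r i * ‖c i‖) := by rw [← hprod]; ring
  have hεr : ε * ‖c i‖ ≤ ε * (r i * ‖c i‖) := by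
    gcongr
    exact le_mul_of_one_le_left (norm_nonneg _) hri
  rw [norm_sub_rev] at hci
  calc _ ≤ _ := norm_sub_le_norm_sub_add_norm_sub _
        ((C (c d) * ∏ j : Fin d, (X - C (xt j))).coeff i) _
    _ ≤ ((1 + ε) ^ (d - i) - 1) * W * (r i * ‖c i‖) + ε * (r i * ‖c i‖) :=
        add_le_add hdiff (hci.trans hεr)
    _ = (ε + ((1 + ε) ^ (d - i) - 1) * W) * r i * ‖c i‖ := by ring
end

section
/- Let d ≥ 1 and let c₀, …, c_d ∈ ℂ be nonzero with induced subdivision 0 = β₀ < β₁ < … < β_s = d and constants r_i. Fix ℓ ∈ {1, …, s} and set τ = τ^{(ℓ)}. Let ε ≥ 0, let δ₀, …, δ_{d−1} ∈ ℂ with |δ_i| ≤ ε for all i, and define Δf(x) = Σ_{i=0}^{d−1} c_i·r_i·δ_i·x^i. Then for every x ∈ ℂ with |x| = e^{τ}: |Δf(x)| ≤ d·ε·|c_{β_ℓ}|·e^{β_ℓ·τ} and |x·Δf'(x)| ≤ d²·ε·|c_{β_ℓ}|·e^{β_ℓ·τ}. -/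
open Polynomial

/-- A natural number below the last term of a finite sequence starting at `0` lies in one of
the consecutive blocks cut out by that sequence. -/
theorem exists_block_of_lt {β : ℕ → ℕ} {s i : ℕ} (hβ0 : β 0 = 0) (hi : i < β s) :
    ∃ k, k < s ∧ β k ≤ i ∧ i < β (k + 1) := by
  induction s with
  | zero => omega
  | succ n ih =>
    by_cases h : i < β n
    · obtain ⟨k, hk, hki⟩ := ih h
      exact ⟨k, by omega, hki⟩
    · exact ⟨n, by omega, by omega, hi⟩

/-- A real sequence which increases up to the index `ℓ` and decreases from `ℓ` to `s` is
maximal at `ℓ`. -/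
theorem le_of_unimodal {g : ℕ → ℝ} {ℓ s : ℕ} (hℓs : ℓ ≤ s)
    (hup : ∀ k, k < ℓ → g k ≤ g (k + 1))
    (hdown : ∀ k, ℓ ≤ k → k < s → g (k + 1) ≤ g k) {k : ℕ} (hk : k ≤ s) :
    g k ≤ g ℓ := by
  rcases le_total k ℓ with h | h
  · induction h using Nat.decreasingInduction with
    | self => exact le_rfl
    | of_succ k hkℓ ih => exact (hup k hkℓ).trans (ih (by omega))
  · induction k, h using Nat.le_induction with
    | base => exact le_rfl
    | succ k hℓk ih => exact (hdown k hℓk hk).trans (ih (by omega))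

/-- A concave piecewise linear function with nodes `β k`, values `w k` at the nodes and slope
`-τ (k + 1)` between `β k` and `β (k + 1)` lies below its supporting line of slope `-τ ℓ`
through the node `β ℓ`. -/
theorem piecewise_linear_add_le {s : ℕ} {β : ℕ → ℕ} {w τ : ℕ → ℝ}
    (hβ : ∀ k, k < s → β k < β (k + 1))
    (hw : ∀ k, k < s → w k = w (k + 1) + ((β (k + 1) : ℝ) - β k) * τ (k + 1))
    (hτ : ∀ k, 1 ≤ k → k < s → τ k < τ (k + 1))
    {ℓ : ℕ} (hℓ1 : 1 ≤ ℓ) (hℓs : ℓ ≤ s) {k i : ℕ} (hk : k < s)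
    (hki : β k ≤ i) (hik : i ≤ β (k + 1)) :
    w (k + 1) + ((β (k + 1) : ℝ) - i) * τ (k + 1) + i * τ ℓ ≤ w ℓ + β ℓ * τ ℓ := by
  have hmono : ∀ a b, 1 ≤ a → a ≤ b → b ≤ s → τ a ≤ τ b := by
    intro a b ha hab
    induction b, hab using Nat.le_induction with
    | base => exact fun _ => le_rfl
    | succ b hab ih => exact fun hb => (ih (by omega)).trans (hτ b (by omega) hb).le
  have hβ' : ∀ k, k < s → (0 : ℝ) ≤ (β (k + 1) : ℝ) - β k := fun k hk =>
    sub_nonneg.2 (Nat.cast_le.2 (hβ k hk).le)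
  have hmax : ∀ k, k ≤ s → w k + β k * τ ℓ ≤ w ℓ + β ℓ * τ ℓ := by
    intro k hk
    refine le_of_unimodal (g := fun k => w k + β k * τ ℓ) hℓs
      (fun k hkℓ => ?_) (fun k hℓk hks => ?_) hk
    · have := mul_le_mul_of_nonneg_left (hmono (k + 1) ℓ (by omega) hkℓ hℓs)
        (hβ' k (by omega))
      have := hw k (by omega)
      linarith
    · have := mul_le_mul_of_nonneg_left (hmono ℓ (k + 1) hℓ1 (by omega) hks) (hβ' k hks)
      have := hw k hks
      linarith
  have hki' : (β k : ℝ) ≤ i := Nat.cast_le.2 hki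
  have hik' : (i : ℝ) ≤ β (k + 1) := Nat.cast_le.2 hik
  rcases lt_or_ge k ℓ with h | h
  · have := mul_le_mul_of_nonneg_left (hmono (k + 1) ℓ (by omega) h hℓs)
      (sub_nonneg.2 hik')
    linarith [hmax (k + 1) hk]
  · have := mul_le_mul_of_nonneg_left (hmono ℓ (k + 1) hℓ1 (by omega) hk)
      (sub_nonneg.2 hki')
    linarith [hmax k hk.le, hw k hk]

/-- Termwise bounds `‖a i * x ^ i‖ ≤ B` for `i < d` bound a polynomial `∑ a i X ^ i` and its
Euler derivative at `x`. -/
theorem norm_eval_sum_le_and_norm_mul_eval_derivative_sum_le {d : ℕ} {a : ℕ → ℂ} {x : ℂ}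
    {B : ℝ} (h : ∀ i, i < d → ‖a i * x ^ i‖ ≤ B) :
    ‖(∑ i ∈ Finset.range d, C (a i) * X ^ i).eval x‖ ≤ d * B ∧
      ‖x * (∑ i ∈ Finset.range d, C (a i) * X ^ i).derivative.eval x‖ ≤ d ^ 2 * B := by
  constructor
  · rw [eval_finsetSum]
    refine (norm_sum_le_of_le _ (n := fun _ => B) fun i hi => ?_).trans (by simp)
    simpa using h i (Finset.mem_range.1 hi)
  · rw [derivative_sum, eval_finsetSum, Finset.mul_sum]
    refine (norm_sum_le_of_le _ (n := fun _ => d * B) fun i hi => ?_).trans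
      (by simp [sq, mul_assoc])
    have hid := Finset.mem_range.1 hi
    have key : x * ((C (a i) * X ^ i).derivative).eval x = i * (a i * x ^ i) := by
      rcases i with _ | i
      · simp
      · simp only [derivative_C_mul_X_pow, eval_mul, eval_C, eval_pow, eval_X]
        rw [Nat.add_sub_cancel]
        ring
    rw [key, norm_mul, Complex.norm_natCast]
    exact mul_le_mul (Nat.cast_le.2 hid.le) (h i hid) (norm_nonneg _) (Nat.cast_nonneg _)

/-- precise form of the first two estimates of Lemma 3.6 of the paper.  For
the tropical-backward-error perturbation `Δf(x) = Σ_{i<d} c_i r_i δ_i x^i` with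
`|δ_i| ≤ ε`, at any point of modulus `e^{τ^{(ℓ)}}` one has
`|Δf(x)| ≤ d ε |c_{β_ℓ}| e^{β_ℓ τ^{(ℓ)}}` and
`|x Δf'(x)| ≤ d² ε |c_{β_ℓ}| e^{β_ℓ τ^{(ℓ)}}`. -/
theorem tropical_perturbation_bounds
    (d s : ℕ) (hd : 1 ≤ d) (hs : 1 ≤ s)
    (c : ℕ → ℂ) (hc : ∀ i, i ≤ d → c i ≠ 0)
    (v : ℕ → ℝ) (hv : ∀ i, v i = Real.log ‖c i‖)
    (β : ℕ → ℕ) (hβ0 : β 0 = 0) (hβs : β s = d)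
    (hβmono : ∀ ℓ, ℓ < s → β ℓ < β (ℓ + 1))
    (τ : ℕ → ℝ)
    (hτ : ∀ ℓ, 1 ≤ ℓ → ℓ ≤ s →
      τ ℓ = (v (β (ℓ - 1)) - v (β ℓ)) / ((β ℓ : ℝ) - (β (ℓ - 1) : ℝ)))
    (hτmono : ∀ ℓ, 1 ≤ ℓ → ℓ < s → τ ℓ < τ (ℓ + 1))
    (hupper : ∀ ℓ i, 1 ≤ ℓ → ℓ ≤ s → β (ℓ - 1) ≤ i → i ≤ β ℓ →
      v i ≤ v (β ℓ) + ((β ℓ : ℝ) - (i : ℝ)) * τ ℓ)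
    (r : ℕ → ℝ)
    (hr : ∀ ℓ i, 1 ≤ ℓ → ℓ ≤ s → β (ℓ - 1) ≤ i → i ≤ β ℓ →
      r i = Real.exp (v (β ℓ) + ((β ℓ : ℝ) - (i : ℝ)) * τ ℓ - v i))
    (ℓ : ℕ) (hℓ1 : 1 ≤ ℓ) (hℓs : ℓ ≤ s)
    (ε : ℝ) (hε : 0 ≤ ε)
    (δ : ℕ → ℂ) (hδ : ∀ i, i < d → ‖δ i‖ ≤ ε)
    (Δf : Polynomial ℂ)
    (hΔf : Δf = ∑ i ∈ Finset.range d, C (c i * (r i : ℂ) * δ i) * X ^ i)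
    (x : ℂ) (hxmod : ‖x‖ = Real.exp (τ ℓ)) :
    ‖Δf.eval x‖ ≤ d * ε * (‖c (β ℓ)‖ * Real.exp ((β ℓ : ℝ) * τ ℓ)) ∧
      ‖x * Δf.derivative.eval x‖ ≤
        d ^ 2 * ε * (‖c (β ℓ)‖ * Real.exp ((β ℓ : ℝ) * τ ℓ)) := by
  have hexp : ∀ i, i ≤ d → ‖c i‖ = Real.exp (v i) := fun i hi => by
    rw [hv, Real.exp_log (norm_pos_iff.2 (hc i hi))]
  have hβd : β ℓ ≤ d := by
    have hmon : ∀ b, ℓ ≤ b → b ≤ s → β ℓ ≤ β b := by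
      intro b hb
      induction b, hb using Nat.le_induction with
      | base => exact fun _ => le_rfl
      | succ b hb ih => exact fun hbs => (ih (by omega)).trans (hβmono b hbs).le
    exact hβs ▸ hmon s hℓs le_rfl
  have hw : ∀ k, k < s →
      v (β k) = v (β (k + 1)) + ((β (k + 1) : ℝ) - β k) * τ (k + 1) := by
    intro k hk
    have hne : (β (k + 1) : ℝ) - β k ≠ 0 := (sub_pos.2 (Nat.cast_lt.2 (hβmono k hk))).ne'
    rw [hτ (k + 1) (by omega) hk, Nat.add_sub_cancel, mul_div_cancel₀ _ hne]
    ring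
  have hterm : ∀ i, i < d → ‖c i * (r i : ℂ) * δ i * x ^ i‖ ≤
      ε * (‖c (β ℓ)‖ * Real.exp ((β ℓ : ℝ) * τ ℓ)) := by
    intro i hi
    obtain ⟨k, hk, hki, hik⟩ := exists_block_of_lt hβ0 (hβs.symm ▸ hi)
    have hri := hr (k + 1) i (by omega) hk hki hik.le
    calc ‖c i * (r i : ℂ) * δ i * x ^ i‖
        = ‖δ i‖ * Real.exp (v (β (k + 1)) + ((β (k + 1) : ℝ) - i) * τ (k + 1)
            + i * τ ℓ) := by
          rw [norm_mul, norm_mul, norm_mul, norm_pow, hxmod, hexp i hi.le, hri,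
            Complex.norm_real, Real.norm_eq_abs, Real.abs_exp, ← Real.exp_nat_mul,
            ← Real.exp_add, mul_comm _ ‖δ i‖, mul_assoc, ← Real.exp_add]
          ring_nf
      _ ≤ ε * Real.exp (v (β ℓ) + β ℓ * τ ℓ) :=
          mul_le_mul (hδ i hi) (Real.exp_le_exp.2 (piecewise_linear_add_le
            (w := fun k => v (β k)) hβmono hw hτmono hℓ1 hℓs hk hki hik.le))
            (Real.exp_nonneg _) hε
      _ = ε * (‖c (β ℓ)‖ * Real.exp ((β ℓ : ℝ) * τ ℓ)) := by
          rw [hexp _ hβd, Real.exp_add]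
  rw [hΔf, mul_assoc (d : ℝ), mul_assoc ((d : ℝ) ^ 2)]
  exact norm_eval_sum_le_and_norm_mul_eval_derivative_sum_le hterm
end
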